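/- Under Assumption A, for every bounded set Ω ⊂ ℝ^{2n} there is C > 0 such that for all (x,ξ) ∈ Ω, all λ ≥ 1 and all t ∈ ℝ, the Hamilton flow of p^λ satisfies λ^{−2}|y^λ(t;x,ξ)|² + |η^λ(t;x,ξ)|² ≤ C; in particular |y^λ(t;x,ξ)| ≤ C'⟨t⟩ and |η^λ(t;x,ξ)| ≤ C' for all t ∈ ℝ with some C' > 0 depending only on Ω and the constants in Assumption A. -/

import Mathlib

open Real Filter
open scoped BigOperators Topology

noncomputable section

/-- Euclidean configuration space `ℝⁿ`. -/
abbrev En (n : ℕ) := EuclideanSpace ℝ (Fin n)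

/-- Partial derivative `∂f/∂x_j` of a function on `ℝⁿ`. -/
noncomputable def pd {n : ℕ} (f : En n → ℝ) (j : Fin n) (x : En n) : ℝ :=
  fderiv ℝ f x (EuclideanSpace.single j 1)

/-- Japanese bracket `⟨x⟩ = (1+|x|²)^{1/2}` on `ℝⁿ`. -/
noncomputable def jb {n : ℕ} (x : En n) : ℝ := Real.sqrt (1 + ‖x‖ ^ 2)

/-- Japanese bracket `⟨t⟩` on `ℝ`. -/
noncomputable def jbR (t : ℝ) : ℝ := Real.sqrt (1 + t ^ 2)

/-- Kronecker delta. -/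
def kdelta {n : ℕ} (j k : Fin n) : ℝ := if j = k then 1 else 0

/-- Assumption A: smooth symmetric positive-definite coefficients `a_{jk}` which are a
short-range perturbation of `δ_{jk}`, and a potential `V = O(⟨x⟩^{2-μ})`, with symbol-type
bounds on all derivatives. -/
structure AssumptionA (n : ℕ) (a : Fin n → Fin n → En n → ℝ) (V : En n → ℝ) (μ : ℝ) : Prop where
  n_pos : 0 < n
  one_lt_mu : 1 < μ
  smooth_a : ∀ j k, ContDiff ℝ (⊤ : ℕ∞) (a j k)
  smooth_V : ContDiff ℝ (⊤ : ℕ∞) V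
  symm : ∀ j k x, a j k x = a k j x
  posdef : ∀ x (ξ : En n), ξ ≠ 0 → 0 < ∑ j, ∑ k, a j k x * ξ j * ξ k
  decay_a : ∀ (m : ℕ) (j k : Fin n), ∃ C > 0, ∀ x,
      ‖iteratedFDeriv ℝ m (fun y => a j k y - kdelta j k) x‖ ≤ C * jb x ^ (-μ - (m : ℝ))
  decay_V : ∀ (m : ℕ), ∃ C > 0, ∀ x,
      ‖iteratedFDeriv ℝ m V x‖ ≤ C * jb x ^ (2 - μ - (m : ℝ))

/-- Kinetic energy symbol `k(x,ξ) = ½ Σ a_{jk}(x) ξ_j ξ_k`. -/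
noncomputable def ksym {n : ℕ} (a : Fin n → Fin n → En n → ℝ) (x ξ : En n) : ℝ :=
  (1 / 2) * ∑ j, ∑ k, a j k x * ξ j * ξ k

/-- Full symbol `p(x,ξ) = k(x,ξ) + ½|x|² + V(x)`. -/
noncomputable def psym {n : ℕ} (a : Fin n → Fin n → En n → ℝ) (V : En n → ℝ) (x ξ : En n) : ℝ :=
  ksym a x ξ + ‖x‖ ^ 2 / 2 + V x

/-- Scaled symbol `p^λ(x,ξ) = k(x,ξ) + |x|²/(2λ²) + V(x)/λ²`. -/
noncomputable def plam {n : ℕ} (a : Fin n → Fin n → En n → ℝ) (V : En n → ℝ) (lam : ℝ)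
    (x ξ : En n) : ℝ :=
  ksym a x ξ + ‖x‖ ^ 2 / (2 * lam ^ 2) + V x / lam ^ 2

/-- `(y,η)` is a (global) solution of the Hamilton equations of `k(x,ξ)=½Σa_{jk}(x)ξ_jξ_k`. -/
def IsFlowK {n : ℕ} (a : Fin n → Fin n → En n → ℝ) (y η : ℝ → En n) : Prop :=
  (∀ t (j : Fin n), HasDerivAt (fun s => y s j) (∑ i, a j i (y t) * η t i) t) ∧
  (∀ t (j : Fin n), HasDerivAt (fun s => η s j)
      (-((1 / 2) * ∑ i, ∑ l, pd (a i l) j (y t) * η t i * η t l)) t)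

/-- `(y,η)` is a (global) solution of the Hamilton equations of `p(x,ξ)`. -/
def IsFlowP {n : ℕ} (a : Fin n → Fin n → En n → ℝ) (V : En n → ℝ) (y η : ℝ → En n) : Prop :=
  (∀ t (j : Fin n), HasDerivAt (fun s => y s j) (∑ i, a j i (y t) * η t i) t) ∧
  (∀ t (j : Fin n), HasDerivAt (fun s => η s j)
      (-((1 / 2) * ∑ i, ∑ l, pd (a i l) j (y t) * η t i * η t l + y t j + pd V j (y t))) t)

/-- `(y,η)` is a (global) solution of the Hamilton equations of `p^λ(x,ξ)`. -/
def IsFlowPlam {n : ℕ} (a : Fin n → Fin n → En n → ℝ) (V : En n → ℝ) (lam : ℝ)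
    (y η : ℝ → En n) : Prop :=
  (∀ t (j : Fin n), HasDerivAt (fun s => y s j) (∑ i, a j i (y t) * η t i) t) ∧
  (∀ t (j : Fin n), HasDerivAt (fun s => η s j)
      (-((1 / 2) * ∑ i, ∑ l, pd (a i l) j (y t) * η t i * η t l
          + y t j / lam ^ 2 + pd V j (y t) / lam ^ 2)) t)

/-- First (position) component of `exp(-tH_{p₀^λ})` applied to `(y t, η t)`:
`z^λ(t) = cos(t/λ) y^λ(t) − λ sin(t/λ) η^λ(t)`. -/
noncomputable def zlam {n : ℕ} (lam : ℝ) (y η : ℝ → En n) (t : ℝ) : En n :=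
  Real.cos (t / lam) • y t - (lam * Real.sin (t / lam)) • η t

/-- Second (momentum) component: `ζ^λ(t) = λ⁻¹ sin(t/λ) y^λ(t) + cos(t/λ) η^λ(t)`. -/
noncomputable def zetalam {n : ℕ} (lam : ℝ) (y η : ℝ → En n) (t : ℝ) : En n :=
  (lam⁻¹ * Real.sin (t / lam)) • y t + Real.cos (t / lam) • η t

end

lemma one_le_jb {n : ℕ} (x : En n) : 1 ≤ jb x :=
  Real.one_le_sqrt.2 (by nlinarith [sq_nonneg ‖x‖])

lemma jb_sq {n : ℕ} (x : En n) : jb x ^ 2 = 1 + ‖x‖ ^ 2 :=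
  Real.sq_sqrt (by positivity)

lemma norm_le_jb {n : ℕ} (x : En n) : ‖x‖ ≤ jb x :=
  Real.le_sqrt_of_sq_le (by linarith)

lemma jb_le_one_add_norm {n : ℕ} (x : En n) : jb x ≤ 1 + ‖x‖ :=
  Real.sqrt_le_iff.2 ⟨by positivity, by nlinarith [norm_nonneg x]⟩

lemma norm_le_of_forall_abs_le {n : ℕ} {v : En n} {B : ℝ} (h : ∀ j, |v j| ≤ B) :
    ‖v‖ ≤ n * B := by
  have hsum : v = ∑ j, v j • EuclideanSpace.single j (1 : ℝ) := by
    ext k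
    simp [Finset.sum_apply, Pi.single_apply]
  rw [hsum]
  refine (norm_sum_le _ _).trans ?_
  calc ∑ j, ‖v j • EuclideanSpace.single j (1 : ℝ)‖ ≤ ∑ _j : Fin n, B :=
        Finset.sum_le_sum fun j _ => by simpa [norm_smul] using h j
    _ = n * B := by simp

lemma abs_sum_sum_mul_mul_le {n : ℕ} {b : Fin n → Fin n → ℝ} {B : ℝ}
    (h : ∀ j k, |b j k| ≤ B) (ξ : En n) :
    |∑ j, ∑ k, b j k * ξ j * ξ k| ≤ n ^ 2 * B * ‖ξ‖ ^ 2 := by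
  have hterm : ∀ j k, |b j k * ξ j * ξ k| ≤ B * ‖ξ‖ * ‖ξ‖ := fun j k => by
    have hB : 0 ≤ B := (abs_nonneg _).trans (h j k)
    have hj : |ξ j| ≤ ‖ξ‖ := PiLp.norm_apply_le ξ j
    have hk : |ξ k| ≤ ‖ξ‖ := PiLp.norm_apply_le ξ k
    have hjk := h j k
    rw [abs_mul, abs_mul]
    gcongr
  calc |∑ j, ∑ k, b j k * ξ j * ξ k| ≤ ∑ j, ∑ k, |b j k * ξ j * ξ k| :=
        (Finset.abs_sum_le_sum_abs _ _).trans
          (Finset.sum_le_sum fun j _ => Finset.abs_sum_le_sum_abs _ _)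
    _ ≤ ∑ _j : Fin n, ∑ _k : Fin n, B * ‖ξ‖ * ‖ξ‖ :=
        Finset.sum_le_sum fun j _ => Finset.sum_le_sum fun k _ => hterm j k
    _ = n ^ 2 * B * ‖ξ‖ ^ 2 := by simp; ring

lemma abs_sum_mul_le {n : ℕ} {b : Fin n → ℝ} {B : ℝ} (h : ∀ i, |b i| ≤ B) (ξ : En n) :
    |∑ i, b i * ξ i| ≤ n * (B * ‖ξ‖) := by
  calc |∑ i, b i * ξ i| ≤ ∑ i, |b i * ξ i| := Finset.abs_sum_le_sum_abs _ _
    _ ≤ ∑ _i : Fin n, B * ‖ξ‖ := Finset.sum_le_sum fun i _ => by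
        have hB : 0 ≤ B := (abs_nonneg _).trans (h i)
        have hi : |ξ i| ≤ ‖ξ‖ := PiLp.norm_apply_le ξ i
        have hbi := h i
        rw [abs_mul]
        gcongr
    _ = n * (B * ‖ξ‖) := by simp

lemma hasDerivAt_of_forall_apply {n : ℕ} {y : ℝ → En n} {v : Fin n → ℝ} {t : ℝ}
    (h : ∀ j, HasDerivAt (fun s => y s j) (v j) t) : HasDerivAt y (WithLp.toLp 2 v) t := by
  rw [hasDerivAt_iff_hasFDerivAt, ← hasFDerivWithinAt_univ, hasFDerivWithinAt_euclidean]
  intro j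
  rw [hasFDerivWithinAt_univ]
  have heq : (PiLp.proj 2 fun _ : Fin n => ℝ) j ∘L
      ContinuousLinearMap.toSpanSingleton ℝ (WithLp.toLp 2 v : En n)
        = ContinuousLinearMap.toSpanSingleton ℝ (v j) := by
    ext
    simp
  exact heq ▸ (h j).hasFDerivAt

lemma HasDerivAt.comp_pd {n : ℕ} {f : En n → ℝ} (hf : Differentiable ℝ f) {y : ℝ → En n}
    {v : Fin n → ℝ} {t : ℝ} (h : ∀ j, HasDerivAt (fun s => y s j) (v j) t) :
    HasDerivAt (fun s => f (y s)) (∑ j, pd f j (y t) * v j) t := by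
  have hsum : (WithLp.toLp 2 v : En n) = ∑ j, v j • EuclideanSpace.single j (1 : ℝ) := by
    ext k
    simp [Finset.sum_apply, Pi.single_apply]
  have := (hf (y t)).hasFDerivAt.comp_hasDerivAt t (hasDerivAt_of_forall_apply h)
  have heq : fderiv ℝ f (y t) (WithLp.toLp 2 v) = ∑ j, pd f j (y t) * v j := by
    rw [hsum, map_sum]
    exact Finset.sum_congr rfl fun j _ => by simp [pd, mul_comm]
  exact heq ▸ this

namespace AssumptionA

variable {n : ℕ} {a : Fin n → Fin n → En n → ℝ} {V : En n → ℝ} {μ : ℝ}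

lemma exists_abs_sub_kdelta_le (hA : AssumptionA n a V μ) :
    ∃ D > 0, ∀ j k x, |a j k x - kdelta j k| ≤ D / jb x := by
  choose C hC h using hA.decay_a 0
  have hS : ∀ j k, C j k ≤ ∑ j, ∑ k, C j k := fun j k =>
    (Finset.single_le_sum (f := fun k => C j k) (fun k _ => (hC j k).le) (Finset.mem_univ k)).trans
      (Finset.single_le_sum (f := fun j => ∑ k, C j k)
        (fun j _ => Finset.sum_nonneg fun k _ => (hC j k).le) (Finset.mem_univ j))
  refine ⟨1 + ∑ j, ∑ k, C j k, ?_, fun j k x => ?_⟩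
  · have : 0 ≤ ∑ j, ∑ k, C j k :=
      Finset.sum_nonneg fun j _ => Finset.sum_nonneg fun k _ => (hC j k).le
    linarith
  · have hx := h j k x
    rw [norm_iteratedFDeriv_zero, Real.norm_eq_abs] at hx
    have hpow : jb x ^ (-μ - ((0 : ℕ) : ℝ)) ≤ (jb x)⁻¹ := by
      rw [← Real.rpow_neg_one]
      exact Real.rpow_le_rpow_of_exponent_le (one_le_jb x)
        (by have := hA.one_lt_mu; push_cast; linarith)
    have hjb := one_le_jb x
    rw [div_eq_mul_inv]
    refine hx.trans (mul_le_mul (by linarith [hS j k]) hpow (by positivity) ?_)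
    linarith [hS j k, hC j k]

lemma exists_abs_coeff_le (hA : AssumptionA n a V μ) : ∃ B > 0, ∀ j k x, |a j k x| ≤ B := by
  obtain ⟨D, hD, h⟩ := hA.exists_abs_sub_kdelta_le
  refine ⟨D + 1, by positivity, fun j k x => ?_⟩
  have h1 : |a j k x - kdelta j k| ≤ D := (h j k x).trans (div_le_self hD.le (one_le_jb x))
  have h2 : |kdelta j k| ≤ 1 := by unfold kdelta; split_ifs <;> simp
  have := abs_add_le (a j k x - kdelta j k) (kdelta j k)
  rw [sub_add_cancel] at this
  linarith

lemma exists_abs_potential_le (hA : AssumptionA n a V μ) :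
    ∃ C > 0, ∀ x, |V x| ≤ C * jb x := by
  obtain ⟨C, hC, h⟩ := hA.decay_V 0
  refine ⟨C, hC, fun x => ?_⟩
  have hx := h x
  rw [norm_iteratedFDeriv_zero, Real.norm_eq_abs] at hx
  refine hx.trans ?_
  gcongr
  calc jb x ^ (2 - μ - ((0 : ℕ) : ℝ)) ≤ jb x ^ (1 : ℝ) :=
        Real.rpow_le_rpow_of_exponent_le (one_le_jb x)
          (by have := hA.one_lt_mu; push_cast; linarith)
    _ = jb x := Real.rpow_one _

lemma exists_elliptic_const_unit_sphere (hA : AssumptionA n a V μ) :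
    ∃ c > 0, ∀ x (ξ : En n), ‖ξ‖ = 1 → c ≤ ∑ j, ∑ k, a j k x * ξ j * ξ k := by
  obtain ⟨D, hD, h⟩ := hA.exists_abs_sub_kdelta_le
  set R : ℝ := 2 * n ^ 2 * D
  have hR : 0 ≤ R := by positivity
  have hfar : ∀ x (ξ : En n), R ≤ jb x → ‖ξ‖ = 1 →
      1 / 2 ≤ ∑ j, ∑ k, a j k x * ξ j * ξ k := fun x ξ hx hξ => by
    have hjb : 0 < jb x := one_pos.trans_le (one_le_jb x)
    have hdiff := abs_sum_sum_mul_mul_le (fun j k => h j k x) ξ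
    have hsplit : ∑ j, ∑ k, (a j k x - kdelta j k) * ξ j * ξ k
        = ∑ j, ∑ k, a j k x * ξ j * ξ k - ‖ξ‖ ^ 2 := by
      rw [EuclideanSpace.real_norm_sq_eq]
      simp [sub_mul, Finset.sum_sub_distrib, kdelta, pow_two]
    have hsmall : n ^ 2 * (D / jb x) ≤ 1 / 2 := by
      rw [← mul_div_assoc, div_le_iff₀ hjb]
      linarith
    rw [hsplit, hξ] at hdiff
    linarith [(abs_le.1 hdiff).1]
  have hcont : Continuous fun p : En n × En n => ∑ j, ∑ k, a j k p.1 * p.2 j * p.2 k := by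
    have := fun j k => (hA.smooth_a j k).continuous
    fun_prop
  have hK : IsCompact (Metric.closedBall (0 : En n) R ×ˢ Metric.sphere (0 : En n) 1) :=
    (isCompact_closedBall _ _).prod (isCompact_sphere _ _)
  have hne : (Metric.closedBall (0 : En n) R ×ˢ Metric.sphere (0 : En n) 1).Nonempty :=
    ⟨(0, EuclideanSpace.single ⟨0, hA.n_pos⟩ 1), by simp [hR]⟩
  obtain ⟨p, hp, hmin⟩ := hK.exists_isMinOn hne hcont.continuousOn
  have hp0 : p.2 ≠ 0 := by
    rintro h0
    have := hp.2
    simp [h0] at this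
  refine ⟨min (1 / 2) (∑ j, ∑ k, a j k p.1 * p.2 j * p.2 k),
    lt_min (by norm_num) (hA.posdef p.1 p.2 hp0), fun x ξ hξ => ?_⟩
  rcases le_total R ‖x‖ with hx | hx
  · exact (min_le_left _ _).trans (hfar x ξ (hx.trans (norm_le_jb x)) hξ)
  · exact (min_le_right _ _).trans
      (hmin (show (x, ξ) ∈ _ from ⟨by simpa using hx, by simpa using hξ⟩))

lemma exists_elliptic_const (hA : AssumptionA n a V μ) :
    ∃ c > 0, ∀ x (ξ : En n), c * ‖ξ‖ ^ 2 ≤ ∑ j, ∑ k, a j k x * ξ j * ξ k := by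
  obtain ⟨c, hc, h⟩ := hA.exists_elliptic_const_unit_sphere
  refine ⟨c, hc, fun x ξ => ?_⟩
  rcases eq_or_ne ξ 0 with rfl | hξ
  · simp
  have hn : 0 < ‖ξ‖ := norm_pos_iff.2 hξ
  have hu := h x (‖ξ‖⁻¹ • ξ) (norm_smul_inv_norm (𝕜 := ℝ) hξ)
  have hscale : ∑ j, ∑ k, a j k x * (‖ξ‖⁻¹ • ξ) j * (‖ξ‖⁻¹ • ξ) k
      = (∑ j, ∑ k, a j k x * ξ j * ξ k) / ‖ξ‖ ^ 2 := by
    simp only [Finset.sum_div]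
    refine Finset.sum_congr rfl fun j _ => Finset.sum_congr rfl fun k _ => ?_
    simp only [PiLp.smul_apply, smul_eq_mul]
    field_simp
  rwa [hscale, le_div_iff₀ (by positivity)] at hu

lemma hasDerivAt_plam (hA : AssumptionA n a V μ) {lam : ℝ} {y η : ℝ → En n}
    (hf : IsFlowPlam a V lam y η) (t : ℝ) :
    HasDerivAt (fun s => plam a V lam (y s) (η s)) 0 t := by
  obtain ⟨hy, hη⟩ := hf
  set v : Fin n → ℝ := fun j => ∑ i, a j i (y t) * η t i with hv
  set w : Fin n → ℝ := fun j => -((1 / 2) * ∑ i, ∑ l, pd (a i l) j (y t) * η t i * η t l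
          + y t j / lam ^ 2 + pd V j (y t) / lam ^ 2) with hw
  have hk : HasDerivAt (fun s => ksym a (y s) (η s))
      ((1 / 2) * ∑ j, ∑ k, (((∑ i, pd (a j k) i (y t) * v i) * η t j + a j k (y t) * w j) * η t k
        + a j k (y t) * η t j * w k)) t := by
    refine HasDerivAt.const_mul _ (HasDerivAt.fun_sum fun j _ => HasDerivAt.fun_sum fun k _ => ?_)
    exact (((HasDerivAt.comp_pd ((hA.smooth_a j k).differentiable (by simp)) (hy t)).mul
      (hη t j)).mul (hη t k))
  have hn : HasDerivAt (fun s => ‖y s‖ ^ 2) (∑ j, 2 * y t j * v j) t := by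
    simp only [EuclideanSpace.real_norm_sq_eq]
    refine HasDerivAt.fun_sum fun j _ => ?_
    have h2 := (hy t j).fun_pow 2
    norm_num at h2
    exact h2
  have hV := HasDerivAt.comp_pd (hA.smooth_V.differentiable (by simp)) (hy t)
  have hall := (hk.add (hn.div_const (2 * lam ^ 2))).add (hV.div_const (lam ^ 2))
  have hzero : (1 / 2) * ∑ j, ∑ k, (((∑ i, pd (a j k) i (y t) * v i) * η t j
        + a j k (y t) * w j) * η t k + a j k (y t) * η t j * w k)
      + (∑ j, 2 * y t j * v j) / (2 * lam ^ 2) + (∑ j, pd V j (y t) * v j) / lam ^ 2 = 0 := by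
    have h1 : ∑ j, ∑ k, (∑ i, pd (a j k) i (y t) * v i) * η t j * η t k
        = ∑ i, v i * ∑ j, ∑ k, pd (a j k) i (y t) * η t j * η t k := by
      simp only [Finset.sum_mul, Finset.mul_sum]
      rw [Finset.sum_comm (s := Finset.univ (α := Fin n)) (t := Finset.univ)
        (f := fun i j => ∑ k, v i * (pd (a j k) i (y t) * η t j * η t k))]
      refine Finset.sum_congr rfl fun j _ => ?_
      rw [Finset.sum_comm]
      exact Finset.sum_congr rfl fun k _ => Finset.sum_congr rfl fun i _ => by ring
    have h2 : ∑ j, ∑ k, a j k (y t) * w j * η t k = ∑ j, v j * w j := by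
      refine Finset.sum_congr rfl fun j _ => ?_
      simp only [hv, Finset.sum_mul]
      exact Finset.sum_congr rfl fun k _ => by ring
    have h3 : ∑ j, ∑ k, a j k (y t) * η t j * w k = ∑ j, v j * w j := by
      rw [Finset.sum_comm, ← h2]
      refine Finset.sum_congr rfl fun j _ => Finset.sum_congr rfl fun k _ => ?_
      rw [hA.symm k j]
      ring
    have h4 : ∑ j, ∑ k, (((∑ i, pd (a j k) i (y t) * v i) * η t j
        + a j k (y t) * w j) * η t k + a j k (y t) * η t j * w k)
        = ∑ i, v i * ∑ j, ∑ k, pd (a j k) i (y t) * η t j * η t k + 2 * ∑ j, v j * w j := by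
      simp only [add_mul, Finset.sum_add_distrib]
      rw [h1, h2, h3]
      ring
    rw [h4, mul_add, Finset.mul_sum, Finset.mul_sum, Finset.mul_sum, Finset.sum_div,
      Finset.sum_div, ← Finset.sum_add_distrib, ← Finset.sum_add_distrib,
      ← Finset.sum_add_distrib]
    refine Finset.sum_eq_zero fun j _ => ?_
    simp only [hw]
    ring
  rw [← hzero]
  exact hall

lemma plam_eq_plam_zero (hA : AssumptionA n a V μ) {lam : ℝ} {y η : ℝ → En n}
    (hf : IsFlowPlam a V lam y η) (t : ℝ) :
    plam a V lam (y t) (η t) = plam a V lam (y 0) (η 0) :=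
  is_const_of_deriv_eq_zero (fun s => (hA.hasDerivAt_plam hf s).differentiableAt)
    (fun s => (hA.hasDerivAt_plam hf s).deriv) t 0

lemma exists_plam_le (hA : AssumptionA n a V μ) (R : ℝ) :
    ∃ E > 0, ∀ x ξ : En n, ‖x‖ ≤ R → ‖ξ‖ ≤ R → ∀ lam : ℝ, 1 ≤ lam → plam a V lam x ξ ≤ E := by
  obtain ⟨B, hB, hBa⟩ := hA.exists_abs_coeff_le
  obtain ⟨C, hC, hCV⟩ := hA.exists_abs_potential_le
  refine ⟨n ^ 2 * B * R ^ 2 + R ^ 2 + C * (1 + |R|), by positivity, fun x ξ hx hξ lam hlam => ?_⟩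
  have hlam2 : 1 ≤ lam ^ 2 := one_le_pow₀ hlam
  have h1 : ksym a x ξ ≤ n ^ 2 * B * R ^ 2 := by
    have h := (le_abs_self _).trans (abs_sum_sum_mul_mul_le (fun j k => hBa j k x) ξ)
    have hpos : 0 ≤ n ^ 2 * B * ‖ξ‖ ^ 2 := by positivity
    have hle : n ^ 2 * B * ‖ξ‖ ^ 2 ≤ n ^ 2 * B * R ^ 2 := by gcongr
    unfold ksym
    linarith
  have h2 : ‖x‖ ^ 2 / (2 * lam ^ 2) ≤ R ^ 2 :=
    (div_le_self (by positivity) (by linarith)).trans (by gcongr)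
  have h3 : V x / lam ^ 2 ≤ C * (1 + |R|) := by
    calc V x / lam ^ 2 ≤ |V x| / lam ^ 2 := by gcongr; exact le_abs_self _
      _ ≤ |V x| := div_le_self (abs_nonneg _) hlam2
      _ ≤ C * jb x := hCV x
      _ ≤ C * (1 + |R|) := by
        gcongr
        exact (jb_le_one_add_norm x).trans (by linarith [le_abs_self R])
  unfold plam
  linarith

lemma exists_le_plam (hA : AssumptionA n a V μ) :
    ∃ c > 0, ∃ K > 0, ∀ x ξ : En n, ∀ lam : ℝ, 1 ≤ lam →
      c * (‖x‖ ^ 2 / lam ^ 2 + ‖ξ‖ ^ 2) ≤ plam a V lam x ξ + K := by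
  obtain ⟨c, hc, hca⟩ := hA.exists_elliptic_const
  obtain ⟨C, hC, hCV⟩ := hA.exists_abs_potential_le
  refine ⟨min (c / 2) (1 / 4), by positivity, 1 / 4 + C ^ 2, by positivity,
    fun x ξ lam hlam => ?_⟩
  have hlam2 : 1 ≤ lam ^ 2 := one_le_pow₀ hlam
  have h1 : c / 2 * ‖ξ‖ ^ 2 ≤ ksym a x ξ := by
    unfold ksym
    linarith [hca x ξ]
  have hVx : -(‖x‖ ^ 2 / 4 + (1 / 4 + C ^ 2)) ≤ V x := by
    have := (abs_le.1 (hCV x)).1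
    nlinarith [sq_nonneg (jb x / 2 - C), jb_sq x]
  have h2 : -(‖x‖ ^ 2 / lam ^ 2 / 4) - (1 / 4 + C ^ 2) ≤ V x / lam ^ 2 := by
    have hdiv := div_le_div_of_nonneg_right hVx (zero_le_one.trans hlam2)
    have hK : (1 / 4 + C ^ 2) / lam ^ 2 ≤ 1 / 4 + C ^ 2 := div_le_self (by positivity) hlam2
    have heq : -(‖x‖ ^ 2 / 4 + (1 / 4 + C ^ 2)) / lam ^ 2
        = -(‖x‖ ^ 2 / lam ^ 2 / 4) - (1 / 4 + C ^ 2) / lam ^ 2 := by ring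
    linarith
  have h3 : ‖x‖ ^ 2 / (2 * lam ^ 2) = ‖x‖ ^ 2 / lam ^ 2 / 2 := by ring
  have h4 : min (c / 2) (1 / 4) * (‖x‖ ^ 2 / lam ^ 2) ≤ 1 / 4 * (‖x‖ ^ 2 / lam ^ 2) := by
    gcongr
    exact min_le_right _ _
  have h5 : min (c / 2) (1 / 4) * ‖ξ‖ ^ 2 ≤ c / 2 * ‖ξ‖ ^ 2 := by
    gcongr
    exact min_le_left _ _
  unfold plam
  linarith

lemma exists_norm_position_le (hA : AssumptionA n a V μ) :
    ∃ L > 0, ∀ (lam : ℝ) (y η : ℝ → En n), IsFlowPlam a V lam y η →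
      ∀ M, (∀ t, ‖η t‖ ≤ M) → ∀ t, ‖y t‖ ≤ ‖y 0‖ + L * M * |t| := by
  obtain ⟨B, hB, hBa⟩ := hA.exists_abs_coeff_le
  have hn : (0 : ℝ) < n := by exact_mod_cast hA.n_pos
  refine ⟨n * (n * B), by positivity, fun lam y η hf M hM t => ?_⟩
  have hM0 : 0 ≤ M := (norm_nonneg _).trans (hM 0)
  have hspeed : ∀ s, ‖(WithLp.toLp 2 fun j => ∑ i, a j i (y s) * η s i : En n)‖
      ≤ n * (n * B) * M := fun s => by
    rw [mul_assoc]
    refine norm_le_of_forall_abs_le fun j => ?_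
    calc |∑ i, a j i (y s) * η s i| ≤ n * (B * ‖η s‖) := abs_sum_mul_le (fun i => hBa j i _) _
      _ ≤ n * (B * M) := by gcongr; exact hM s
      _ = n * B * M := by ring
  have hmv := convex_univ.norm_image_sub_le_of_norm_hasDerivWithin_le
    (fun s _ => (hasDerivAt_of_forall_apply (hf.1 s)).hasDerivWithinAt) (fun s _ => hspeed s)
    (Set.mem_univ 0) (Set.mem_univ t)
  rw [sub_zero, Real.norm_eq_abs] at hmv
  have := norm_add_le (y 0) (y t - y 0)
  rw [add_sub_cancel] at this
  linarith

end AssumptionA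

/-- Under Assumption A, for every bounded set `Ω ⊂ ℝ^{2n}` there is `C > 0`
such that for all `(x,ξ) ∈ Ω`, `λ ≥ 1` and `t ∈ ℝ`, the flow of `p^λ` satisfies
`λ⁻²|y^λ(t)|² + |η^λ(t)|² ≤ C`; in particular `|y^λ(t)| ≤ C'⟨t⟩` and `|η^λ(t)| ≤ C'`
with some `C' > 0` depending only on `Ω` and the constants of Assumption A. -/
theorem stmt_2 {n : ℕ} (a : Fin n → Fin n → En n → ℝ) (V : En n → ℝ) (μ : ℝ)
    (hA : AssumptionA n a V μ) (Ω : Set (En n × En n)) (hΩ : Bornology.IsBounded Ω) :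
    ∃ C > (0 : ℝ), ∃ C' > (0 : ℝ), ∀ x ξ : En n, (x, ξ) ∈ Ω → ∀ lam : ℝ, 1 ≤ lam →
      ∀ y η : ℝ → En n, IsFlowPlam a V lam y η → y 0 = x → η 0 = ξ →
        ∀ t : ℝ, (‖y t‖ ^ 2 / lam ^ 2 + ‖η t‖ ^ 2 ≤ C) ∧
          ‖y t‖ ≤ C' * jbR t ∧ ‖η t‖ ≤ C' := by
  obtain ⟨R, hR, hΩR⟩ := hΩ.exists_pos_norm_le
  obtain ⟨E, hE, hEle⟩ := hA.exists_plam_le R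
  obtain ⟨c, hc, K, hK, hcK⟩ := hA.exists_le_plam
  obtain ⟨L, hL, hLy⟩ := hA.exists_norm_position_le
  set C := (E + K) / c
  set M := √C
  have hC : 0 < C := by positivity
  have hM : 0 < M := Real.sqrt_pos.2 hC
  refine ⟨C, hC, R + L * M + M, by positivity, fun x ξ hxξ lam hlam y η hf hy0 hη0 => ?_⟩
  have hx : ‖x‖ ≤ R := (norm_fst_le (x, ξ)).trans (hΩR _ hxξ)
  have hξ : ‖ξ‖ ≤ R := (norm_snd_le (x, ξ)).trans (hΩR _ hxξ)
  have henergy : ∀ t, ‖y t‖ ^ 2 / lam ^ 2 + ‖η t‖ ^ 2 ≤ C := fun t => by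
    rw [le_div_iff₀ hc, mul_comm]
    refine (hcK (y t) (η t) lam hlam).trans ?_
    rw [hA.plam_eq_plam_zero hf t, hy0, hη0]
    linarith [hEle x ξ hx hξ lam hlam]
  have hη : ∀ t, ‖η t‖ ≤ M := fun t => by
    refine Real.le_sqrt_of_sq_le ?_
    have : 0 ≤ ‖y t‖ ^ 2 / lam ^ 2 := by positivity
    linarith [henergy t]
  intro t
  refine ⟨henergy t, ?_, (hη t).trans (by linarith [mul_pos hL hM])⟩
  have hjb1 : 1 ≤ jbR t := Real.one_le_sqrt.2 (by nlinarith [sq_nonneg t])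
  have hjbt : |t| ≤ jbR t := Real.abs_le_sqrt (by linarith)
  calc ‖y t‖ ≤ ‖y 0‖ + L * M * |t| := hLy lam y η hf M hη t
    _ ≤ R * jbR t + L * M * jbR t := by
        rw [hy0]
        gcongr
        nlinarith
    _ ≤ (R + L * M + M) * jbR t := by nlinarith
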